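/- arXiv:math/0503377 — 2 statements merged into one kernel-verified Lean document; each statement's English description precedes it below -/
import Mathlib

section
/- Define F : SL_2(\mathbb{C}) \to \mathbb{C}^2 by F(g) = \big( (A(\Pi_1(g)))_{11},\, (A(\Pi_1(g)))_{22} \big), the diagonal entries of T\,\sigma(g)^{-1} g\,T^{-1}. Then: (a) for every g \in SL_2(\mathbb{C}) both components of F(g) are real numbers; (b) the image of F is exactly \{ (s,t) \in \mathbb{R}^2 : s t \le 1 \}; (c) for g, h \in SL_2(\mathbb{C}), F(g) = F(h) if and only if there exist \gamma \in SL_2(\mathbb{R}) and k \in SO_2(\mathbb{R}) with h = \gamma\, g\, k^{-1}. Thus F realizes the quotient of SL_2(\mathbb{C}) by the action of L = SL_2(\mathbb{R}) \times SO_2(\mathbb{R}) by left and right multiplication, with model \mathcal{P} = \{(s,t) : st \le 1\}. -/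
/-- The entrywise complex conjugation `σ` of `SL₂(ℂ)` (fixing `SL₂(ℝ)`), at the matrix level. -/
def sigmaConj (g : Matrix (Fin 2) (Fin 2) ℂ) : Matrix (Fin 2) (Fin 2) ℂ :=
  g.map (starRingEnd ℂ)

/-- The matrix `T = (1/√2)·[[1, i],[i, 1]]` conjugating `SL₂(ℝ)` onto `SU(1,1)`. -/
noncomputable def T : Matrix (Fin 2) (Fin 2) ℂ :=
  ((Real.sqrt 2 : ℂ))⁻¹ • !![1, Complex.I; Complex.I, 1]

/-- `F(g)` = the two diagonal entries of `T σ(g)⁻¹ g T⁻¹`. -/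
noncomputable def Fmap (g : Matrix (Fin 2) (Fin 2) ℂ) : ℂ × ℂ :=
  ((T * (sigmaConj g)⁻¹ * g * T⁻¹) 0 0, (T * (sigmaConj g)⁻¹ * g * T⁻¹) 1 1)

/-- The rotation matrix in `SO₂(ℝ)`, regarded as a complex matrix. -/
noncomputable def rot (θ : ℝ) : Matrix (Fin 2) (Fin 2) ℂ :=
  !![(Real.cos θ : ℂ), -(Real.sin θ : ℂ); (Real.sin θ : ℂ), (Real.cos θ : ℂ)]

open Complex Matrix

/-- The map `Π₁(g) = σ(g)⁻¹ g`. -/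
noncomputable def piOne (g : Matrix (Fin 2) (Fin 2) ℂ) : Matrix (Fin 2) (Fin 2) ℂ :=
  (sigmaConj g)⁻¹ * g

/-- The matrices `M` of trace `2x` with `M σ(M) = 1` when `x² + y² + r² - d² = 1`. -/
noncomputable def symmMat (x y r d : ℝ) : Matrix (Fin 2) (Fin 2) ℂ :=
  !![x + I * y, I * (r + d); I * (r - d), x - I * y]

lemma sigmaConj_mul (g h : Matrix (Fin 2) (Fin 2) ℂ) :
    sigmaConj (g * h) = sigmaConj g * sigmaConj h :=
  Matrix.map_mul

lemma sigmaConj_det (g : Matrix (Fin 2) (Fin 2) ℂ) :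
    (sigmaConj g).det = starRingEnd ℂ g.det :=
  ((starRingEnd ℂ).map_det g).symm

lemma sigmaConj_map_ofReal (γ : Matrix (Fin 2) (Fin 2) ℝ) :
    sigmaConj (γ.map ofReal) = γ.map ofReal := by
  ext i j
  simp [sigmaConj]

lemma sigmaConj_rot (θ : ℝ) : sigmaConj (rot θ) = rot θ := by
  ext i j
  fin_cases i <;> fin_cases j <;> simp [sigmaConj, rot, -ofReal_cos, -ofReal_sin]

lemma ofReal_cos_sq_add_sin_sq (θ : ℝ) :
    (Real.cos θ : ℂ) ^ 2 + (Real.sin θ : ℂ) ^ 2 = 1 := by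
  exact_mod_cast Real.cos_sq_add_sin_sq θ

lemma rot_det (θ : ℝ) : (rot θ).det = 1 := by
  rw [rot, det_fin_two_of]
  linear_combination ofReal_cos_sq_add_sin_sq θ

lemma map_ofReal_det (γ : Matrix (Fin 2) (Fin 2) ℝ) :
    (γ.map ofReal).det = (γ.det : ℂ) :=
  (ofRealHom.map_det γ).symm

lemma T_inv : T⁻¹ = ((Real.sqrt 2 : ℂ))⁻¹ • !![1, -I; -I, 1] := by
  apply inv_eq_right_inv
  have h : ((Real.sqrt 2 : ℂ))⁻¹ * ((Real.sqrt 2 : ℂ))⁻¹ = 1 / 2 := by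
    rw [← mul_inv, ← ofReal_mul, Real.mul_self_sqrt zero_le_two]
    norm_num
  rw [T, smul_mul_smul_comm, h]
  ext i j
  fin_cases i <;> fin_cases j <;> simp <;> norm_num

lemma Fmap_eq (g : Matrix (Fin 2) (Fin 2) ℂ) :
    Fmap g =
      ((piOne g 0 0 + piOne g 1 1 - I * (piOne g 0 1 - piOne g 1 0)) / 2,
        (piOne g 0 0 + piOne g 1 1 + I * (piOne g 0 1 - piOne g 1 0)) / 2) := by
  have h : ((Real.sqrt 2 : ℂ))⁻¹ * ((Real.sqrt 2 : ℂ))⁻¹ = 1 / 2 := by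
    rw [← mul_inv, ← ofReal_mul, Real.mul_self_sqrt zero_le_two]
    norm_num
  have hT : T * (sigmaConj g)⁻¹ * g * T⁻¹ =
      (1 / 2 : ℂ) • (!![1, I; I, 1] * piOne g * !![1, -I; -I, 1]) := by
    rw [Matrix.mul_assoc T, T_inv, T, smul_mul_assoc, smul_mul_smul_comm, h, piOne]
  rw [Fmap, hT]
  generalize piOne g = M
  obtain ⟨a, b, c, d, rfl⟩ : ∃ a b c d : ℂ, M = !![a, b; c, d] := ⟨_, _, _, _, eta_fin_two M⟩
  ext <;> simp
  · linear_combination (-d / 2) * I_sq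
  · linear_combination (-a / 2) * I_sq

lemma exists_piOne_eq_symmMat (g : Matrix (Fin 2) (Fin 2) ℂ) (hg : g.det = 1) :
    ∃ x y r d : ℝ, x ^ 2 + y ^ 2 + r ^ 2 - d ^ 2 = 1 ∧ piOne g = symmMat x y r d := by
  have hs : (sigmaConj g).det = 1 := by rw [sigmaConj_det, hg, map_one]
  have key : piOne g = symmMat
      (g 0 0 * starRingEnd ℂ (g 1 1) - g 1 0 * starRingEnd ℂ (g 0 1)).re
      (g 0 0 * starRingEnd ℂ (g 1 1) - g 1 0 * starRingEnd ℂ (g 0 1)).im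
      ((g 0 1 * starRingEnd ℂ (g 1 1)).im + (g 1 0 * starRingEnd ℂ (g 0 0)).im)
      ((g 0 1 * starRingEnd ℂ (g 1 1)).im - (g 1 0 * starRingEnd ℂ (g 0 0)).im) := by
    rw [piOne, Matrix.inv_def, hs, adjugate_fin_two]
    ext i j
    fin_cases i <;> fin_cases j <;> apply Complex.ext <;>
      simp [sigmaConj, symmMat, Matrix.mul_apply, Fin.sum_univ_two] <;> ring
  refine ⟨_, _, _, _, ?_, key⟩
  have hdet : (piOne g).det = 1 := by
    rw [piOne, det_mul, det_nonsing_inv, hs, hg]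
    simp
  rw [key, symmMat, det_fin_two_of] at hdet
  apply ofReal_injective
  push_cast at hdet ⊢
  linear_combination hdet +
    ((g 0 0 * starRingEnd ℂ (g 1 1) - g 1 0 * starRingEnd ℂ (g 0 1)).im ^ 2
      + 4 * (g 0 1 * starRingEnd ℂ (g 1 1)).im * (g 1 0 * starRingEnd ℂ (g 0 0)).im : ℂ) * I_sq

lemma Fmap_of_piOne_eq {g : Matrix (Fin 2) (Fin 2) ℂ} {x y r d : ℝ}
    (h : piOne g = symmMat x y r d) :
    Fmap g = (((x + d : ℝ) : ℂ), ((x - d : ℝ) : ℂ)) := by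
  rw [Fmap_eq, h]
  ext <;> simp [symmMat]
  · linear_combination (-d : ℂ) * I_sq
  · linear_combination (d : ℂ) * I_sq

lemma piOne_eq_of_mul_eq {g M : Matrix (Fin 2) (Fin 2) ℂ} (hg : g.det = 1)
    (h : sigmaConj g * M = g) : piOne g = M := by
  have hs : IsUnit (sigmaConj g).det := by rw [sigmaConj_det, hg, map_one]; exact isUnit_one
  rw [piOne]
  nth_rw 2 [← h]
  rw [nonsing_inv_mul_cancel_left _ _ hs]

/-- Hilbert 90 for `SL₂(ℂ)` over `SL₂(ℝ)`. -/
lemma exists_piOne_of_symmMat (x r d : ℝ) (h : x ^ 2 + r ^ 2 - d ^ 2 = 1) :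
    ∃ g : Matrix (Fin 2) (Fin 2) ℂ, g.det = 1 ∧ piOne g = symmMat x 0 r d := by
  have hC : (x ^ 2 + r ^ 2 - d ^ 2 : ℂ) = 1 := by exact_mod_cast h
  rcases lt_or_ge (-1) x with hx | hx
  · have hu : (Real.sqrt (2 + 2 * x) : ℂ) ^ 2 = 2 + 2 * x := by
      exact_mod_cast Real.sq_sqrt (by linarith : 0 ≤ 2 + 2 * x)
    have hu0 : (Real.sqrt (2 + 2 * x) : ℂ) ≠ 0 := by
      exact_mod_cast (Real.sqrt_pos.2 (by linarith : 0 < 2 + 2 * x)).ne'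
    generalize Real.sqrt (2 + 2 * x) = u at hu hu0
    have hdet : det !![(1 + x : ℂ) / u, I * (r + d) / u; I * (r - d) / u, (1 + x) / u] = 1 := by
      rw [det_fin_two_of]
      field_simp
      linear_combination hC - hu - (r ^ 2 - d ^ 2 : ℂ) * I_sq
    refine ⟨_, hdet, piOne_eq_of_mul_eq hdet ?_⟩
    ext i j
    fin_cases i <;> fin_cases j <;>
      simp [sigmaConj, symmMat, Matrix.mul_apply, Fin.sum_univ_two] <;> field_simp
    · linear_combination hC - (r ^ 2 - d ^ 2 : ℂ) * I_sq
    · ring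
    · ring
    · linear_combination hC - (r ^ 2 - d ^ 2 : ℂ) * I_sq
  · have hu : (Real.sqrt (2 - 2 * x) : ℂ) ^ 2 = 2 - 2 * x := by
      exact_mod_cast Real.sq_sqrt (by linarith : 0 ≤ 2 - 2 * x)
    have hu0 : (Real.sqrt (2 - 2 * x) : ℂ) ≠ 0 := by
      exact_mod_cast (Real.sqrt_pos.2 (by linarith : 0 < 2 - 2 * x)).ne'
    generalize Real.sqrt (2 - 2 * x) = u at hu hu0
    have hdet : det !![I * (1 - x : ℂ) / u, (r + d) / u; -(r - d) / u, -(I * (1 - x)) / u] = 1 := by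
      rw [det_fin_two_of]
      field_simp
      linear_combination hC - hu - (1 - x : ℂ) ^ 2 * I_sq
    refine ⟨_, hdet, piOne_eq_of_mul_eq hdet ?_⟩
    ext i j
    fin_cases i <;> fin_cases j <;>
      simp [sigmaConj, symmMat, Matrix.mul_apply, Fin.sum_univ_two] <;> field_simp
    · linear_combination hC
    · linear_combination (-(1 - x) * (r + d) : ℂ) * I_sq
    · linear_combination ((1 - x) * (r - d) : ℂ) * I_sq
    · linear_combination (-1 : ℂ) * hC

lemma exists_rotation {a b c d : ℝ} (h : a ^ 2 + b ^ 2 = c ^ 2 + d ^ 2) :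
    ∃ φ : ℝ, c = Real.cos φ * a - Real.sin φ * b ∧ d = Real.sin φ * a + Real.cos φ * b := by
  have hn : ‖(⟨a, b⟩ : ℂ)‖ = ‖(⟨c, d⟩ : ℂ)‖ := by
    rw [← sq_eq_sq₀ (norm_nonneg _) (norm_nonneg _), Complex.sq_norm, Complex.sq_norm,
      normSq_mk, normSq_mk]
    linarith
  have key : (⟨c, d⟩ : ℂ) =
      exp (((arg ⟨c, d⟩ - arg ⟨a, b⟩ : ℝ) : ℂ) * I) * (⟨a, b⟩ : ℂ) := by
    calc (⟨c, d⟩ : ℂ) = ‖(⟨c, d⟩ : ℂ)‖ * exp (arg ⟨c, d⟩ * I) :=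
          (norm_mul_exp_arg_mul_I _).symm
      _ = exp (((arg ⟨c, d⟩ - arg ⟨a, b⟩ : ℝ) : ℂ) * I) *
          (‖(⟨a, b⟩ : ℂ)‖ * exp (arg ⟨a, b⟩ * I)) := by
        rw [hn, mul_left_comm, ← Complex.exp_add]
        push_cast
        ring_nf
      _ = _ := by rw [norm_mul_exp_arg_mul_I]
  refine ⟨arg ⟨c, d⟩ - arg ⟨a, b⟩, ?_, ?_⟩
  · have := congrArg re key
    simpa only [mul_re, exp_ofReal_mul_I_re, exp_ofReal_mul_I_im] using this
  · have := congrArg im key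
    simp only [mul_im, exp_ofReal_mul_I_re, exp_ofReal_mul_I_im] at this
    linarith

lemma symmMat_mul_rot (x y r d θ : ℝ) :
    symmMat x (Real.cos (2 * θ) * y - Real.sin (2 * θ) * r)
      (Real.sin (2 * θ) * y + Real.cos (2 * θ) * r) d * rot θ = rot θ * symmMat x y r d := by
  have h := ofReal_cos_sq_add_sin_sq θ
  rw [Real.cos_two_mul', Real.sin_two_mul]
  ext i j
  fin_cases i <;> fin_cases j <;>
    simp [rot, symmMat, Matrix.mul_apply, Fin.sum_univ_two, -ofReal_cos, -ofReal_sin]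
  all_goals generalize (Real.cos θ : ℂ) = C at *
  all_goals generalize (Real.sin θ : ℂ) = S at *
  · linear_combination (I * (C * y + S * r * (-1))) * h
  · linear_combination (I * (S * y + C * r)) * h
  · linear_combination (I * (S * y + C * r)) * h
  · linear_combination (I * (-C * y + S * r)) * h

lemma piOne_real_mul_rot_inv (g : Matrix (Fin 2) (Fin 2) ℂ) (γ : Matrix (Fin 2) (Fin 2) ℝ)
    (hγ : γ.det = 1) (θ : ℝ) :
    piOne (γ.map ofReal * g * (rot θ)⁻¹) = rot θ * piOne g * (rot θ)⁻¹ := by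
  have hk : IsUnit (rot θ).det := by rw [rot_det]; exact isUnit_one
  have hγ' : IsUnit (γ.map ofReal).det := by rw [map_ofReal_det, hγ]; simp
  have hinv : sigmaConj (rot θ)⁻¹ = (rot θ)⁻¹ := by
    refine (inv_eq_right_inv ?_).symm
    nth_rw 1 [← sigmaConj_rot θ]
    rw [← sigmaConj_mul, mul_nonsing_inv _ hk]
    simp [sigmaConj]
  rw [piOne, piOne, sigmaConj_mul, sigmaConj_mul, sigmaConj_map_ofReal, hinv,
    Matrix.mul_inv_rev, Matrix.mul_inv_rev, nonsing_inv_nonsing_inv _ hk]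
  simp only [Matrix.mul_assoc]
  rw [nonsing_inv_mul_cancel_left _ _ hγ']

lemma Fmap_real_mul_rot_inv (g : Matrix (Fin 2) (Fin 2) ℂ) (γ : Matrix (Fin 2) (Fin 2) ℝ)
    (hg : g.det = 1) (hγ : γ.det = 1) (θ : ℝ) :
    Fmap (γ.map ofReal * g * (rot θ)⁻¹) = Fmap g := by
  obtain ⟨x, y, r, d, -, hM⟩ := exists_piOne_eq_symmMat g hg
  have hk : IsUnit (rot θ).det := by rw [rot_det]; exact isUnit_one
  have h := piOne_real_mul_rot_inv g γ hγ θ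
  rw [hM, ← symmMat_mul_rot, mul_nonsing_inv_cancel_right _ _ hk] at h
  rw [Fmap_of_piOne_eq h, Fmap_of_piOne_eq hM]

lemma exists_real_of_sigmaConj_eq {g : Matrix (Fin 2) (Fin 2) ℂ} (h : sigmaConj g = g) :
    ∃ γ : Matrix (Fin 2) (Fin 2) ℝ, γ.map ofReal = g := by
  refine ⟨g.map re, ?_⟩
  ext i j
  exact conj_eq_iff_re.1 (congrFun (congrFun h i) j)

lemma exists_of_piOne_mul_rot_eq {g h : Matrix (Fin 2) (Fin 2) ℂ} (hg : g.det = 1)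
    (hh : h.det = 1) {θ : ℝ} (H : piOne h * rot θ = rot θ * piOne g) :
    ∃ γ : Matrix (Fin 2) (Fin 2) ℝ, γ.det = 1 ∧ h = γ.map ofReal * g * (rot θ)⁻¹ := by
  have hk : IsUnit (rot θ).det := by rw [rot_det]; exact isUnit_one
  have hgu : IsUnit g.det := by rw [hg]; exact isUnit_one
  have hsg : IsUnit (sigmaConj g).det := by rw [sigmaConj_det, hg, map_one]; exact isUnit_one
  have hsh : IsUnit (sigmaConj h).det := by rw [sigmaConj_det, hh, map_one]; exact isUnit_one
  have hginv : sigmaConj g⁻¹ = (sigmaConj g)⁻¹ := by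
    refine (inv_eq_right_inv ?_).symm
    rw [← sigmaConj_mul, mul_nonsing_inv _ hgu]
    simp [sigmaConj]
  have hreal : sigmaConj (h * rot θ * g⁻¹) = h * rot θ * g⁻¹ := by
    rw [sigmaConj_mul, sigmaConj_mul, sigmaConj_rot, hginv]
    have H' := congrArg (fun M => sigmaConj h * M * g⁻¹) H
    simp only [piOne] at H'
    rw [Matrix.mul_assoc (sigmaConj h)⁻¹, mul_nonsing_inv_cancel_left _ _ hsh,
      ← Matrix.mul_assoc, ← Matrix.mul_assoc, mul_nonsing_inv_cancel_right _ _ hgu] at H'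
    exact H'.symm
  obtain ⟨γ, hγ⟩ := exists_real_of_sigmaConj_eq hreal
  refine ⟨γ, ?_, ?_⟩
  · have hd := map_ofReal_det γ
    rw [hγ, det_mul, det_mul, det_nonsing_inv, hh, rot_det, hg] at hd
    apply ofReal_injective
    rw [← hd]
    simp
  · rw [hγ, nonsing_inv_mul_cancel_right _ _ hgu, mul_nonsing_inv_cancel_right _ _ hk]

/-- (a) both components of `F` are real; (b) the image of `F` is `{(s,t) ∈ ℝ² : st ≤ 1}`;
(c) the fibers of `F` are the orbits of the `SL₂(ℝ) × SO₂(ℝ)`-action by left and right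
multiplication: `F` realizes the quotient of `SL₂(ℂ)` by `L` with model `𝒫 = {st ≤ 1}`. -/
theorem stmt10 :
    (∀ g : Matrix (Fin 2) (Fin 2) ℂ, g.det = 1 → (Fmap g).1.im = 0 ∧ (Fmap g).2.im = 0) ∧
    ({p : ℝ × ℝ | ∃ g : Matrix (Fin 2) (Fin 2) ℂ,
        g.det = 1 ∧ Fmap g = ((p.1 : ℂ), (p.2 : ℂ))} = {p : ℝ × ℝ | p.1 * p.2 ≤ 1}) ∧
    (∀ g h : Matrix (Fin 2) (Fin 2) ℂ, g.det = 1 → h.det = 1 →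
      (Fmap g = Fmap h ↔
        ∃ γ : Matrix (Fin 2) (Fin 2) ℝ, γ.det = 1 ∧
          ∃ θ : ℝ, h = γ.map (Complex.ofReal) * g * (rot θ)⁻¹)) := by
  refine ⟨fun g hg => ?_, ?_, fun g h hg hh => ⟨fun H => ?_, ?_⟩⟩
  · obtain ⟨x, y, r, d, -, hM⟩ := exists_piOne_eq_symmMat g hg
    rw [Fmap_of_piOne_eq hM]
    exact ⟨ofReal_im _, ofReal_im _⟩
  · ext ⟨s, t⟩
    simp only [Set.mem_ofPred_eq]
    constructor
    · rintro ⟨g, hg, hF⟩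
      obtain ⟨x, y, r, d, hxy, hM⟩ := exists_piOne_eq_symmMat g hg
      rw [Fmap_of_piOne_eq hM, Prod.mk.injEq, ofReal_inj, ofReal_inj] at hF
      rw [← hF.1, ← hF.2]
      nlinarith [sq_nonneg y, sq_nonneg r]
    · intro hst
      obtain ⟨g, hg, hM⟩ := exists_piOne_of_symmMat ((s + t) / 2) (Real.sqrt (1 - s * t))
        ((s - t) / 2) (by rw [Real.sq_sqrt (by linarith)]; ring)
      refine ⟨g, hg, ?_⟩
      rw [Fmap_of_piOne_eq hM]
      ring_nf
  · obtain ⟨x, y, r, d, hxy, hM⟩ := exists_piOne_eq_symmMat g hg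
    obtain ⟨x', y', r', d', hxy', hM'⟩ := exists_piOne_eq_symmMat h hh
    rw [Fmap_of_piOne_eq hM, Fmap_of_piOne_eq hM', Prod.mk.injEq, ofReal_inj, ofReal_inj] at H
    obtain rfl : x = x' := by linarith [H.1, H.2]
    obtain rfl : d = d' := by linarith [H.1]
    obtain ⟨φ, hy, hr⟩ := exists_rotation (by linarith : y ^ 2 + r ^ 2 = y' ^ 2 + r' ^ 2)
    have hrot := symmMat_mul_rot x y r d (φ / 2)
    rw [mul_div_cancel₀ φ two_ne_zero, ← hy, ← hr, ← hM, ← hM'] at hrot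
    obtain ⟨γ, hγ, hγh⟩ := exists_of_piOne_mul_rot_eq hg hh hrot
    exact ⟨γ, hγ, φ / 2, hγh⟩
  · rintro ⟨γ, hγ, θ, rfl⟩
    exact (Fmap_real_mul_rot_inv g γ hg hγ θ).symm
end

section
/- Let m > -1. For every u \in \mathbb{R} there exists a unique a > 0 such that 4u^2m^2 - 4a^2 > -\pi^2 and (m/(1+m))\cdot C(4u^2(1+m)^2)/S(4u^2(1+m)^2) = C(4u^2m^2 - 4a^2)/S(4u^2m^2 - 4a^2). (This defines the real-analytic function \gamma whose graph, together with the axis u = 0, constitutes the preimage under the reduced polar map of the diagonal \{s = t\}.) -/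
open Real

/-- `C x = ∑ xⁿ/(2n)!`, i.e. `cosh √x` for `x ≥ 0` and `cos √(-x)` for `x ≤ 0`. -/
noncomputable def C (x : ℝ) : ℝ := ∑' n : ℕ, x ^ n / (Nat.factorial (2 * n))

/-- `S x = ∑ xⁿ/(2n+1)!`, i.e. `sinh √x/√x` for `x > 0` and `sin √(-x)/√(-x)` for `x < 0`. -/
noncomputable def S (x : ℝ) : ℝ := ∑' n : ℕ, x ^ n / (Nat.factorial (2 * n + 1))

theorem summable_C (x : ℝ) : Summable fun n : ℕ => x ^ n / (Nat.factorial (2 * n) : ℝ) := by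
  refine .of_norm_bounded (Real.summable_pow_div_factorial |x|) fun n => ?_
  rw [norm_div, norm_pow, Real.norm_eq_abs, Real.norm_natCast]
  have : Nat.factorial n ≤ Nat.factorial (2 * n) := Nat.factorial_le (by omega)
  gcongr

theorem summable_S (x : ℝ) : Summable fun n : ℕ => x ^ n / (Nat.factorial (2 * n + 1) : ℝ) := by
  refine .of_norm_bounded (Real.summable_pow_div_factorial |x|) fun n => ?_
  rw [norm_div, norm_pow, Real.norm_eq_abs, Real.norm_natCast]
  have : Nat.factorial n ≤ Nat.factorial (2 * n + 1) := Nat.factorial_le (by omega)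
  gcongr

theorem continuous_tsum_pow_div (d : ℕ → ℕ) (hd : ∀ n, Nat.factorial n ≤ d n) :
    Continuous fun x : ℝ => ∑' n : ℕ, x ^ n / (d n : ℝ) := by
  refine continuous_iff_continuousAt.2 fun x₀ => ?_
  have hball : ContinuousOn (fun x : ℝ => ∑' n : ℕ, x ^ n / (d n : ℝ))
      (Metric.ball 0 (|x₀| + 1)) := by
    refine continuousOn_tsum (fun n => by fun_prop)
      (Real.summable_pow_div_factorial (|x₀| + 1)) fun n x hx => ?_
    have hx' : |x| ≤ |x₀| + 1 := by
      rw [mem_ball_zero_iff, Real.norm_eq_abs] at hx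
      exact hx.le
    have := hd n
    rw [norm_div, norm_pow, Real.norm_eq_abs, Real.norm_natCast]
    gcongr
  exact hball.continuousAt (Metric.isOpen_ball.mem_nhds (by simp))

theorem continuous_C : Continuous C :=
  continuous_tsum_pow_div _ fun _ => Nat.factorial_le (by omega)

theorem continuous_S : Continuous S :=
  continuous_tsum_pow_div _ fun _ => Nat.factorial_le (by omega)

theorem C_sq (t : ℝ) : C (t ^ 2) = cosh t := by
  rw [C, ← (Real.hasSum_cosh t).tsum_eq]
  simp only [pow_mul]

theorem mul_S_sq (t : ℝ) : t * S (t ^ 2) = sinh t := by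
  rw [S, ← tsum_mul_left, ← (Real.hasSum_sinh t).tsum_eq]
  congr 1 with n
  ring

theorem C_neg_sq (t : ℝ) : C (-t ^ 2) = cos t := by
  rw [C, ← (Real.hasSum_cos t).tsum_eq]
  congr 1 with n
  rw [neg_pow, pow_mul]

theorem mul_S_neg_sq (t : ℝ) : t * S (-t ^ 2) = sin t := by
  rw [S, ← tsum_mul_left, ← (Real.hasSum_sin t).tsum_eq]
  congr 1 with n
  rw [neg_pow]
  ring

theorem S_strictMonoOn : StrictMonoOn S (Set.Ici 0) := by
  intro x hx y _ hxy
  have hx : 0 ≤ x := hx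
  refine Summable.tsum_lt_tsum (i := 1) (fun n => ?_) ?_ (summable_S x) (summable_S y)
  · gcongr
  · simp only [pow_one]
    gcongr

theorem S_zero : S 0 = 1 := by
  rw [S, tsum_eq_single 0 fun n hn => by simp [hn]]
  simp

theorem C_zero : C 0 = 1 := by
  simpa using C_sq 0

theorem S_lt_C {x : ℝ} (hx : 0 < x) : S x < C x := by
  refine Summable.tsum_lt_tsum (i := 1) (fun n => ?_) ?_ (summable_S x) (summable_C x)
  · have : Nat.factorial (2 * n) ≤ Nat.factorial (2 * n + 1) := Nat.factorial_le (by omega)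
    gcongr
  · norm_num [Nat.factorial]
    linarith

/-- Every negative number above `-π²` is `-t²` for some `t ∈ (0, π)`. -/
theorem exists_eq_neg_sq {x : ℝ} (hx : -π ^ 2 < x) (hx0 : x < 0) :
    ∃ t, 0 < t ∧ t < π ∧ x = -t ^ 2 := by
  refine ⟨√(-x), Real.sqrt_pos.2 (by linarith), ?_, ?_⟩
  · exact (Real.sqrt_lt' pi_pos).2 (by linarith)
  · rw [Real.sq_sqrt (by linarith)]
    ring

theorem S_pos {x : ℝ} (hx : -π ^ 2 < x) : 0 < S x := by
  rcases lt_or_ge x 0 with h | h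
  · obtain ⟨t, ht, htπ, rfl⟩ := exists_eq_neg_sq hx h
    exact pos_of_mul_pos_right (mul_S_neg_sq t ▸ sin_pos_of_pos_of_lt_pi ht htπ) ht.le
  · have := S_strictMonoOn.monotoneOn Set.self_mem_Ici h h
    linarith [S_zero]

theorem C_lt_S {x : ℝ} (hx : -π ^ 2 < x) (hx0 : x < 0) : C x < S x := by
  have hS := S_pos hx
  obtain ⟨t, ht, htπ, rfl⟩ := exists_eq_neg_sq hx hx0
  rw [C_neg_sq]
  rcases lt_or_ge t (π / 2) with h | h
  · have hcos : 0 < cos t := cos_pos_of_mem_Ioo ⟨by linarith, h⟩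
    have htan := lt_tan ht h
    rw [tan_eq_sin_div_cos, lt_div_iff₀ hcos, ← mul_S_neg_sq] at htan
    exact lt_of_mul_lt_mul_left htan ht.le
  · exact (cos_nonpos_of_pi_div_two_le_of_le h (by linarith)).trans_lt hS

/-- `sin t / t` is strictly decreasing on `(0, π)` and nonpositive on `[π, 2π]`. -/
theorem mul_sin_lt_mul_sin {s t : ℝ} (hs : 0 < s) (hst : s < t) (hsπ : s < π) (ht : t ≤ 2 * π) :
    s * sin t < t * sin s := by
  have hsin : 0 < sin s := sin_pos_of_pos_of_lt_pi hs hsπ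
  rcases le_or_gt t π with h | h
  · have ht0 : 0 < t := hs.trans hst
    have hconc := strictConcaveOn_sin_Icc.2 ⟨le_rfl, pi_pos.le⟩ ⟨ht0.le, h⟩ ht0.ne
      (sub_pos.2 ((div_lt_one ht0).2 hst)) (div_pos hs ht0) (sub_add_cancel 1 (s / t))
    simp only [smul_eq_mul, sin_zero, mul_zero, zero_add, div_mul_cancel₀ _ ht0.ne'] at hconc
    rwa [div_mul_eq_mul_div, div_lt_iff₀ ht0, mul_comm (sin s)] at hconc
  · have h' : sin t ≤ 0 := by
      rw [← sin_sub_two_pi]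
      exact sin_nonpos_of_nonpos_of_neg_pi_le (by linarith) (by linarith)
    nlinarith [mul_pos (hs.trans hst) hsin]

theorem mul_sinh_lt_mul_sinh {s t : ℝ} (hs : 0 < s) (hst : s < t) :
    t * sinh s < s * sinh t := by
  have h : S (s ^ 2) < S (t ^ 2) :=
    S_strictMonoOn (sq_nonneg s) (sq_nonneg t) (by gcongr)
  rw [← mul_S_sq, ← mul_S_sq]
  nlinarith [mul_lt_mul_of_pos_left h (mul_pos hs (hs.trans hst))]

/-- `C / S` is strictly increasing on `(-π², ∞)`. -/
theorem C_mul_S_lt {x y : ℝ} (hx : -π ^ 2 < x) (hxy : x < y) : C x * S y < C y * S x := by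
  have hSx := S_pos hx
  have hSy := S_pos (hx.trans hxy)
  rcases lt_trichotomy x 0 with hx0 | rfl | hx0
  · have hCx := C_lt_S hx hx0
    rcases lt_or_ge y 0 with hy0 | hy0
    · obtain ⟨t, ht, htπ, rfl⟩ := exists_eq_neg_sq hx hx0
      obtain ⟨s, hs, hsπ, rfl⟩ := exists_eq_neg_sq (hx.trans hxy) hy0
      have hst : s < t := lt_of_pow_lt_pow_left₀ 2 ht.le (by linarith)
      have key := mul_sin_lt_mul_sin (s := t - s) (t := t + s) (by linarith) (by linarith)
        (by linarith) (by linarith)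
      rw [sin_add, sin_sub, ← mul_S_neg_sq, ← mul_S_neg_sq, ← C_neg_sq, ← C_neg_sq] at key
      have hpos : 0 < 2 * s * t := by positivity
      refine lt_of_mul_lt_mul_left ?_ hpos.le
      linarith
    · have hCy : S y ≤ C y := by
        rcases hy0.eq_or_lt with rfl | h
        · rw [S_zero, C_zero]
        · exact (S_lt_C h).le
      nlinarith [mul_lt_mul_of_pos_right hCx hSy, mul_le_mul_of_nonneg_right hCy hSx.le]
  · simpa [S_zero, C_zero] using S_lt_C hxy
  · have hy0 := hx0.trans hxy
    obtain ⟨s, hs, rfl⟩ : ∃ s, 0 < s ∧ s ^ 2 = x := ⟨√x, Real.sqrt_pos.2 hx0, Real.sq_sqrt hx0.le⟩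
    obtain ⟨t, ht, rfl⟩ : ∃ t, 0 < t ∧ t ^ 2 = y := ⟨√y, Real.sqrt_pos.2 hy0, Real.sq_sqrt hy0.le⟩
    have hst : s < t := lt_of_pow_lt_pow_left₀ 2 ht.le hxy
    have key := mul_sinh_lt_mul_sinh (s := t - s) (t := t + s) (by linarith) (by linarith)
    rw [sinh_add, sinh_sub, ← mul_S_sq, ← mul_S_sq, ← C_sq, ← C_sq] at key
    have hpos : 0 < 2 * s * t := by positivity
    refine lt_of_mul_lt_mul_left ?_ hpos.le
    linarith

theorem C_div_S_strictMonoOn : StrictMonoOn (fun x => C x / S x) (Set.Ioi (-π ^ 2)) := by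
  intro x hx y hy hxy
  exact (div_lt_div_iff₀ (S_pos hx) (S_pos hy)).2 (C_mul_S_lt hx hxy)

theorem S_neg_pi_sq : S (-π ^ 2) = 0 := by
  have h := mul_S_neg_sq π
  rw [sin_pi] at h
  exact (mul_eq_zero.1 h).resolve_left pi_ne_zero

/-- Below any `b > -π²`, the quotient `C / S` takes every value smaller than its value at `b`. -/
theorem exists_C_div_S_eq {b c : ℝ} (hb : -π ^ 2 < b) (hc : c < C b / S b) :
    ∃ y, -π ^ 2 < y ∧ y < b ∧ c = C y / S y := by
  have hcont : ContinuousOn (fun y => C y - c * S y) (Set.Icc (-π ^ 2) b) :=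
    (continuous_C.sub (continuous_const.mul continuous_S)).continuousOn
  have hzero : (0 : ℝ) ∈ Set.Ioo (C (-π ^ 2) - c * S (-π ^ 2)) (C b - c * S b) :=
    ⟨by simp [S_neg_pi_sq, C_neg_sq], sub_pos.2 ((lt_div_iff₀ (S_pos hb)).1 hc)⟩
  obtain ⟨y, ⟨hy, hyb⟩, h0⟩ := intermediate_value_Ioo hb.le hcont hzero
  exact ⟨y, hy, hyb, (eq_div_iff (S_pos hy).ne').2 (sub_eq_zero.1 h0).symm⟩

theorem S_mul_C_sub_C_mul_S (m u : ℝ) :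
    (1 + m) * S (4 * u ^ 2 * (1 + m) ^ 2) * C (4 * u ^ 2 * m ^ 2) -
      m * C (4 * u ^ 2 * (1 + m) ^ 2) * S (4 * u ^ 2 * m ^ 2) = S (4 * u ^ 2) := by
  rcases eq_or_ne u 0 with rfl | hu
  · simp [S_zero, C_zero]
  · have h := sinh_sub (2 * u * (1 + m)) (2 * u * m)
    rw [show 2 * u * (1 + m) - 2 * u * m = 2 * u by ring, ← mul_S_sq, ← mul_S_sq, ← mul_S_sq,
      ← C_sq, ← C_sq] at h
    have h2 : 2 * u ≠ 0 := by positivity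
    rw [show 4 * u ^ 2 * (1 + m) ^ 2 = (2 * u * (1 + m)) ^ 2 by ring,
      show 4 * u ^ 2 * m ^ 2 = (2 * u * m) ^ 2 by ring, show 4 * u ^ 2 = (2 * u) ^ 2 by ring]
    refine mul_left_cancel₀ h2 ?_
    linear_combination -h

theorem mul_C_div_S_lt {m : ℝ} (hm : -1 < m) (u : ℝ) :
    m / (1 + m) * (C (4 * u ^ 2 * (1 + m) ^ 2) / S (4 * u ^ 2 * (1 + m) ^ 2)) <
      C (4 * u ^ 2 * m ^ 2) / S (4 * u ^ 2 * m ^ 2) := by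
  have hpos {x : ℝ} (hx : 0 ≤ x) : 0 < S x := S_pos (by nlinarith [pi_pos])
  have hA : 0 < S (4 * u ^ 2 * (1 + m) ^ 2) := hpos (by positivity)
  have hB : 0 < S (4 * u ^ 2 * m ^ 2) := hpos (by positivity)
  have hu : 0 < S (4 * u ^ 2) := hpos (by positivity)
  have hm' : 0 < 1 + m := by linarith
  rw [div_mul_div_comm, div_lt_div_iff₀ (by positivity) hB]
  linarith [S_mul_C_sub_C_mul_S m u]

/-- For `m > -1` and every `u ∈ ℝ` there is a unique `a > 0` with `4u²m² - 4a² > -π²` and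
`(m/(1+m))·C(4u²(1+m)²)/S(4u²(1+m)²) = C(4u²m² - 4a²)/S(4u²m² - 4a²)`; this defines the
function `γ` whose graph, together with `{u = 0}`, is the preimage of the diagonal `{s = t}`
under the reduced polar map. -/
theorem stmt16 (m : ℝ) (hm : -1 < m) (u : ℝ) :
    ∃! a : ℝ, 0 < a ∧ 4 * u ^ 2 * m ^ 2 - 4 * a ^ 2 > -π ^ 2 ∧
      m / (1 + m) * (C (4 * u ^ 2 * (1 + m) ^ 2) / S (4 * u ^ 2 * (1 + m) ^ 2)) =
        C (4 * u ^ 2 * m ^ 2 - 4 * a ^ 2) / S (4 * u ^ 2 * m ^ 2 - 4 * a ^ 2) := by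
  have hb : -π ^ 2 < 4 * u ^ 2 * m ^ 2 := by
    nlinarith [pi_pos, mul_nonneg (sq_nonneg u) (sq_nonneg m)]
  obtain ⟨y, hy, hyb, hcy⟩ := exists_C_div_S_eq hb (mul_C_div_S_lt hm u)
  have hroot : 0 < √(4 * u ^ 2 * m ^ 2 - y) := Real.sqrt_pos.2 (by linarith)
  have hval : 4 * u ^ 2 * m ^ 2 - 4 * (√(4 * u ^ 2 * m ^ 2 - y) / 2) ^ 2 = y := by
    rw [div_pow, Real.sq_sqrt (by linarith)]
    ring
  refine ⟨√(4 * u ^ 2 * m ^ 2 - y) / 2, ⟨by positivity, ?_, ?_⟩, ?_⟩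
  · rw [hval]
    exact hy
  · rw [hval]
    exact hcy
  · rintro a ⟨ha, hgt, heq⟩
    have hay := C_div_S_strictMonoOn.injOn hgt hy (heq.symm.trans hcy)
    refine (pow_left_inj₀ ha.le (by positivity) two_ne_zero).1 ?_
    linarith
end
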